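/- With Ψ, Ψ* as defined, the algebraic differential relation [-i∂ₜ + α∂ᵤ]Ψ - (1/2)∂ᵤ²Ψ + (Ψ*Ψ)Ψ = (1/2)(2β + α² - 3℘(v) - λ₂)Ψ holds; for λ₂ = 0 this is the elliptic-function form of the nonlinear Schrödinger equation. -/

import Mathlib

open Complex

/-- `WeierstrassData` packages the Weierstrass sigma function `σ` of the period
lattice `Γ = 2ℤω₁ + 2ℤω₂`, together with the zeta function `ζ = σ'/σ` and
`℘ = -(log σ)'' = -ζ'`. -/
structure WeierstrassData where
  σ : ℂ → ℂ
  ζ : ℂ → ℂ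
  ℘ : ℂ → ℂ
  ω₁ : ℂ
  ω₂ : ℂ
  Γ : Set ℂ
  hΓ : Γ = {z : ℂ | ∃ m n : ℤ, z = 2 * m * ω₁ + 2 * n * ω₂}
  nondeg : (ω₂ / ω₁).im ≠ 0
  σ_diff : Differentiable ℂ σ
  σ_zero : ∀ z : ℂ, σ z = 0 ↔ z ∈ Γ
  σ_odd : ∀ z : ℂ, σ (-z) = - σ z
  σ_deriv_zero : deriv σ 0 = 1
  ζ_def : ∀ z ∉ Γ, ζ z = deriv σ z / σ z
  ζ_diff : ∀ z ∉ Γ, DifferentiableAt ℂ ζ z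
  ℘_def : ∀ z ∉ Γ, ℘ z = - deriv ζ z
  ℘_diff : ∀ z ∉ Γ, DifferentiableAt ℂ ℘ z
  ℘_diff2 : ∀ z ∉ Γ, DifferentiableAt ℂ (deriv ℘) z
/-- The curve condition `y² = x³ + λ₂x² + λ₁x + λ₀` for `x = ℘`, `y = ℘'/2`. -/
def WeierstrassData.OnCurveL (W : WeierstrassData) (l2 l1 l0 : ℂ) : Prop :=
  ∀ z ∉ W.Γ, (deriv W.℘ z / 2) ^ 2
    = W.℘ z ^ 3 + l2 * W.℘ z ^ 2 + l1 * W.℘ z + l0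

namespace WeierstrassData

variable (W : WeierstrassData)

lemma countable_Γ : W.Γ.Countable := by
  have : W.Γ = Set.range (fun x : ℤ × ℤ => 2 * (x.1 : ℂ) * W.ω₁ + 2 * (x.2 : ℂ) * W.ω₂) := by
    rw [W.hΓ]
    ext z
    constructor
    · rintro ⟨m, n, h⟩
      exact ⟨(m, n), h.symm⟩
    · rintro ⟨⟨m, n⟩, h⟩
      exact ⟨m, n, h.symm⟩
  rw [this]
  exact Set.countable_range _

lemma σ_ne {z : ℂ} (hz : z ∉ W.Γ) : W.σ z ≠ 0 := fun h => hz ((W.σ_zero z).1 h)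

lemma isOpen_compl : IsOpen (W.Γᶜ) := by
  have : W.Γᶜ = W.σ ⁻¹' {0}ᶜ := by
    ext z
    simp [W.σ_zero]
  rw [this]
  exact isOpen_compl_singleton.preimage W.σ_diff.continuous

lemma ev {z : ℂ} (hz : z ∉ W.Γ) : ∀ᶠ w in nhds z, w ∉ W.Γ := W.isOpen_compl.mem_nhds hz

lemma dense_compl : Dense (W.Γᶜ) := W.countable_Γ.dense_compl ℂ

lemma preconn_compl : IsPreconnected (W.Γᶜ) :=
  (W.countable_Γ.isPathConnected_compl_of_one_lt_rank
    (by rw [Complex.rank_real_complex]; norm_num)).isConnected.isPreconnected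

lemma diff_deriv {f : ℂ → ℂ} (hf : Differentiable ℂ f) : Differentiable ℂ (deriv f) := by
  have h : ContDiff ℂ 2 f := hf.contDiff
  exact (h.iterate_deriv' 1 1).differentiable (by norm_num)

/-- square of sigma -/
noncomputable def S (z : ℂ) : ℂ := W.σ z ^ 2
/-- the entire function ℘ σ² -/
noncomputable def s (z : ℂ) : ℂ := deriv W.σ z ^ 2 - W.σ z * deriv (deriv W.σ) z

lemma S_diff : Differentiable ℂ W.S := W.σ_diff.pow 2
lemma s_diff : Differentiable ℂ W.s := by
  have h1 := diff_deriv W.σ_diff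
  have h2 := diff_deriv h1
  exact (h1.pow 2).sub (W.σ_diff.mul h2)

lemma σ0 : W.σ 0 = 0 := by
  rw [W.σ_zero, W.hΓ]
  exact ⟨0, 0, by simp⟩

lemma S0 : W.S 0 = 0 := by simp [S, W.σ0]
lemma s0 : W.s 0 = 1 := by simp [s, W.σ0, W.σ_deriv_zero]

lemma dσ_even (z : ℂ) : deriv W.σ (-z) = deriv W.σ z := by
  have h : (fun x => W.σ (-x)) = fun x => - W.σ x := funext W.σ_odd
  have h2 := congrArg (fun f => deriv f z) h
  simp only [deriv_comp_neg, deriv.fun_neg] at h2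
  linear_combination -h2

lemma ddσ_odd (z : ℂ) : deriv (deriv W.σ) (-z) = - deriv (deriv W.σ) z := by
  have h : (fun x => deriv W.σ (-x)) = fun x => deriv W.σ x := funext W.dσ_even
  have h2 := congrArg (fun f => deriv f z) h
  simp only [deriv_comp_neg] at h2
  linear_combination -h2

lemma deriv_zero_of_even {f : ℂ → ℂ} (hf : ∀ z, f (-z) = f z) : deriv f 0 = 0 := by
  have h : (fun x => f (-x)) = fun x => f x := funext hf
  have h2 := congrArg (fun f => deriv f 0) h
  simp only [deriv_comp_neg, neg_zero] at h2
  linear_combination (-1/2) * h2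

lemma dS0 : deriv W.S 0 = 0 := deriv_zero_of_even (fun z => by simp [S, W.σ_odd])
lemma ds0 : deriv W.s 0 = 0 :=
  deriv_zero_of_even (fun z => by simp only [s, W.σ_odd, W.dσ_even, W.ddσ_odd]; ring)

lemma dσ {z : ℂ} (hz : z ∉ W.Γ) : deriv W.σ z = W.ζ z * W.σ z := by
  rw [W.ζ_def z hz, div_mul_cancel₀ _ (W.σ_ne hz)]

lemma hζ {z : ℂ} (hz : z ∉ W.Γ) : HasDerivAt W.ζ (- W.℘ z) z := by
  rw [W.℘_def z hz, neg_neg]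
  exact (W.ζ_diff z hz).hasDerivAt

lemma hσ (z : ℂ) : HasDerivAt W.σ (deriv W.σ z) z := (W.σ_diff z).hasDerivAt

lemma ddσ {z : ℂ} (hz : z ∉ W.Γ) :
    deriv (deriv W.σ) z = (W.ζ z ^ 2 - W.℘ z) * W.σ z := by
  have h : deriv W.σ =ᶠ[nhds z] fun w => W.ζ w * W.σ w := by
    filter_upwards [W.ev hz] with w hw using W.dσ hw
  rw [h.deriv_eq, ((W.hζ hz).fun_mul (W.hσ z)).deriv, W.dσ hz]
  ring

lemma s_eq {z : ℂ} (hz : z ∉ W.Γ) : W.s z = W.℘ z * W.S z := by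
  simp only [s, S, W.ddσ hz, W.dσ hz]
  ring

lemma dS' (z : ℂ) : deriv W.S z = 2 * W.σ z * deriv W.σ z := by
  have := ((W.hσ z).fun_pow 2).deriv
  unfold S
  rw [this]; norm_num

lemma dS {z : ℂ} (hz : z ∉ W.Γ) : deriv W.S z = 2 * W.ζ z * W.S z := by
  rw [dS', W.dσ hz, S]; ring

lemma ddS {z : ℂ} (hz : z ∉ W.Γ) :
    deriv (deriv W.S) z = (4 * W.ζ z ^ 2 - 2 * W.℘ z) * W.S z := by
  have h : deriv W.S =ᶠ[nhds z] fun w => 2 * W.ζ w * W.S w := by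
    filter_upwards [W.ev hz] with w hw using W.dS hw
  rw [h.deriv_eq, (((W.hζ hz).const_mul 2).fun_mul (W.S_diff z).hasDerivAt).deriv, W.dS hz]
  ring

lemma ds {z : ℂ} (hz : z ∉ W.Γ) :
    deriv W.s z = (deriv W.℘ z + 2 * W.ζ z * W.℘ z) * W.S z := by
  have h : W.s =ᶠ[nhds z] fun w => W.℘ w * W.S w := by
    filter_upwards [W.ev hz] with w hw using W.s_eq hw
  rw [h.deriv_eq, ((W.℘_diff z hz).hasDerivAt.fun_mul (W.S_diff z).hasDerivAt).deriv, W.dS hz]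
  ring

lemma dds {z : ℂ} (hz : z ∉ W.Γ) :
    deriv (deriv W.s) z = (deriv (deriv W.℘) z + 4 * W.ζ z * deriv W.℘ z
      + (4 * W.ζ z ^ 2 - 2 * W.℘ z) * W.℘ z) * W.S z := by
  have h : deriv W.s =ᶠ[nhds z] fun w => (deriv W.℘ w + 2 * W.ζ w * W.℘ w) * W.S w := by
    filter_upwards [W.ev hz] with w hw using W.ds hw
  rw [h.deriv_eq, (((W.℘_diff2 z hz).hasDerivAt.fun_add
    (((W.hζ hz).const_mul 2).fun_mul (W.℘_diff z hz).hasDerivAt)).fun_mul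
      (W.S_diff z).hasDerivAt).deriv, W.dS hz]
  ring

lemma dd℘ {l2 l1 l0 : ℂ} (hL : W.OnCurveL l2 l1 l0) {z : ℂ} (hz : z ∉ W.Γ) :
    deriv (deriv W.℘) z = 6 * W.℘ z ^ 2 + 4 * l2 * W.℘ z + 2 * l1 := by
  have hd℘ : DifferentiableOn ℂ W.℘ W.Γᶜ := fun w hw => (W.℘_diff w hw).differentiableWithinAt
  have a1 : AnalyticOnNhd ℂ W.℘ W.Γᶜ := hd℘.analyticOnNhd W.isOpen_compl
  have a2 := a1.deriv
  have a3 := a2.deriv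
  have a4 : AnalyticOnNhd ℂ
      (fun w => deriv (deriv W.℘) w - (6 * W.℘ w ^ 2 + 4 * l2 * W.℘ w + 2 * l1)) W.Γᶜ := by
    intro w hw
    have b1 := a1 w hw
    have b3 := a3 w hw
    fun_prop
  have key : ∀ w ∈ W.Γᶜ, deriv W.℘ w *
      (deriv (deriv W.℘) w - (6 * W.℘ w ^ 2 + 4 * l2 * W.℘ w + 2 * l1)) = 0 := by
    intro w hw
    have e : (fun x => (deriv W.℘ x / 2) ^ 2) =ᶠ[nhds w]
        fun x => W.℘ x ^ 3 + l2 * W.℘ x ^ 2 + l1 * W.℘ x + l0 := by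
      filter_upwards [W.ev hw] with x hx using hL x hx
    have h℘ := (W.℘_diff w hw).hasDerivAt
    have h1 := (((W.℘_diff2 w hw).hasDerivAt.div_const 2).fun_pow 2).deriv
    have h2 := ((((h℘.fun_pow 3).fun_add ((h℘.fun_pow 2).const_mul l2)).fun_add
      (h℘.const_mul l1)).add_const l0).deriv
    have h3 := e.deriv_eq
    rw [h1, h2] at h3
    norm_num at h3
    linear_combination 2 * h3
  rcases AnalyticOnNhd.eq_zero_or_eq_zero_of_mul_eq_zero a2 a4 key W.preconn_compl with h | h
  · exfalso
    have hc : ∀ w ∈ W.Γᶜ, W.℘ w = W.℘ z := fun w hw =>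
      W.isOpen_compl.is_const_of_deriv_eq_zero W.preconn_compl hd℘ h hw hz
    have e : W.s = fun w => W.℘ z * W.S w := by
      refine Continuous.ext_on W.dense_compl W.s_diff.continuous
        (continuous_const.mul W.S_diff.continuous) ?_
      intro w hw
      simp only [W.s_eq hw, hc w hw]
    have := congrFun e 0
    simp [W.s0, W.S0] at this
  · exact sub_eq_zero.1 (h z hz)

/-- the entire function in two variables -/
noncomputable def g (u v : ℂ) : ℂ := W.s v * W.S u - W.S v * W.s u
noncomputable def gu (u v : ℂ) : ℂ := W.s v * deriv W.S u - W.S v * deriv W.s u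
noncomputable def gv (u v : ℂ) : ℂ := deriv W.s v * W.S u - deriv W.S v * W.s u
noncomputable def guu (u v : ℂ) : ℂ :=
  W.s v * deriv (deriv W.S) u - W.S v * deriv (deriv W.s) u
noncomputable def gvv (u v : ℂ) : ℂ :=
  deriv (deriv W.s) v * W.S u - deriv (deriv W.S) v * W.s u
noncomputable def guv (u v : ℂ) : ℂ := deriv W.s v * deriv W.S u - deriv W.S v * deriv W.s u

lemma wave {l2 l1 l0 : ℂ} (hL : W.OnCurveL l2 l1 l0) (u v : ℂ) :
    W.g u v * (W.guu u v - W.gvv u v) = W.gu u v ^ 2 - W.gv u v ^ 2 := by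
  have c1 := W.S_diff.continuous
  have c2 := W.s_diff.continuous
  have c3 := (diff_deriv W.S_diff).continuous
  have c4 := (diff_deriv W.s_diff).continuous
  have c5 := (diff_deriv (diff_deriv W.S_diff)).continuous
  have c6 := (diff_deriv (diff_deriv W.s_diff)).continuous
  have A : ∀ u ∉ W.Γ, ∀ v ∉ W.Γ,
      W.g u v * (W.guu u v - W.gvv u v) = W.gu u v ^ 2 - W.gv u v ^ 2 := by
    intro u hu v hv
    simp only [g, gu, gv, guu, gvv, W.s_eq hu, W.s_eq hv, W.dS hu, W.dS hv, W.ds hu, W.ds hv,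
      W.ddS hu, W.ddS hv, W.dds hu, W.dds hv, W.dd℘ hL hu, W.dd℘ hL hv]
    linear_combination (4 * W.S u ^ 2 * W.S v ^ 2) * (hL v hv - hL u hu)
  have B : ∀ v ∉ W.Γ, ∀ u,
      W.g u v * (W.guu u v - W.gvv u v) = W.gu u v ^ 2 - W.gv u v ^ 2 := by
    intro v hv u
    refine congrFun (Continuous.ext_on (f := fun u => W.g u v * (W.guu u v - W.gvv u v))
      (g := fun u => W.gu u v ^ 2 - W.gv u v ^ 2) W.dense_compl ?_ ?_
      (fun u hu => A u hu v hv)) u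
    · unfold g guu gvv; fun_prop
    · unfold gu gv; fun_prop
  refine congrFun (Continuous.ext_on (f := fun v => W.g u v * (W.guu u v - W.gvv u v))
      (g := fun v => W.gu u v ^ 2 - W.gv u v ^ 2) W.dense_compl ?_ ?_
      (fun v hv => B v hv u)) v
  · unfold g guu gvv; fun_prop
  · unfold gu gv; fun_prop

/-- `g` in the variables `p = u + v`, `q = u - v`. -/
noncomputable def G (p q : ℂ) : ℂ := W.g ((p + q) / 2) ((p - q) / 2)
noncomputable def Gp (p q : ℂ) : ℂ :=
  (W.gu ((p + q) / 2) ((p - q) / 2) + W.gv ((p + q) / 2) ((p - q) / 2)) / 2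
noncomputable def Gq (p q : ℂ) : ℂ :=
  (W.gu ((p + q) / 2) ((p - q) / 2) - W.gv ((p + q) / 2) ((p - q) / 2)) / 2
noncomputable def Gpq (p q : ℂ) : ℂ :=
  (W.guu ((p + q) / 2) ((p - q) / 2) - W.gvv ((p + q) / 2) ((p - q) / 2)) / 4

lemma comp_aux {f : ℂ → ℂ} (hf : Differentiable ℂ f) {k : ℂ → ℂ} {k' x : ℂ}
    (hk : HasDerivAt k k' x) : HasDerivAt (fun x => f (k x)) (deriv f (k x) * k') x :=
  (hf (k x)).hasDerivAt.comp x hk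

lemma hGp (p q : ℂ) : HasDerivAt (fun p => W.G p q) (W.Gp p q) p := by
  have e1 : HasDerivAt (fun p : ℂ => (p + q) / 2) (1 / 2) p :=
    ((hasDerivAt_id p).add_const q).div_const 2
  have e2 : HasDerivAt (fun p : ℂ => (p - q) / 2) (1 / 2) p :=
    ((hasDerivAt_id p).sub_const q).div_const 2
  have := ((comp_aux W.s_diff e2).fun_mul (comp_aux W.S_diff e1)).fun_sub
    ((comp_aux W.S_diff e2).fun_mul (comp_aux W.s_diff e1))
  refine this.congr_deriv ?_
  simp only [Gp, gu, gv]; ring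

lemma hGq (p q : ℂ) : HasDerivAt (fun q => W.G p q) (W.Gq p q) q := by
  have e1 : HasDerivAt (fun q : ℂ => (p + q) / 2) (1 / 2) q :=
    ((hasDerivAt_id q).const_add p).div_const 2
  have e2 : HasDerivAt (fun q : ℂ => (p - q) / 2) (-1 / 2) q :=
    ((hasDerivAt_id q).const_sub p).div_const 2
  have := ((comp_aux W.s_diff e2).fun_mul (comp_aux W.S_diff e1)).fun_sub
    ((comp_aux W.S_diff e2).fun_mul (comp_aux W.s_diff e1))
  refine this.congr_deriv ?_
  simp only [Gq, gu, gv]; ring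

lemma hGpq (p q : ℂ) : HasDerivAt (fun q => W.Gp p q) (W.Gpq p q) q := by
  have e1 : HasDerivAt (fun q : ℂ => (p + q) / 2) (1 / 2) q :=
    ((hasDerivAt_id q).const_add p).div_const 2
  have e2 : HasDerivAt (fun q : ℂ => (p - q) / 2) (-1 / 2) q :=
    ((hasDerivAt_id q).const_sub p).div_const 2
  have dS := diff_deriv W.S_diff
  have ds := diff_deriv W.s_diff
  have := ((((comp_aux W.s_diff e2).fun_mul (comp_aux dS e1)).fun_sub
    ((comp_aux W.S_diff e2).fun_mul (comp_aux ds e1))).fun_add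
    (((comp_aux ds e2).fun_mul (comp_aux W.S_diff e1)).fun_sub
    ((comp_aux dS e2).fun_mul (comp_aux W.s_diff e1)))).div_const 2
  refine this.congr_deriv ?_
  simp only [Gpq, guu, gvv]; ring

lemma G_diag (p : ℂ) : W.G p p = W.S p := by
  simp [G, g, W.S0, W.s0]

lemma Gp_diag (p : ℂ) : W.Gp p p = deriv W.S p / 2 := by
  simp [Gp, gu, gv, W.S0, W.s0, W.dS0, W.ds0]

lemma G_cont : Continuous (fun x : ℂ × ℂ => W.G x.1 x.2) := by
  have c1 := W.S_diff.continuous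
  have c2 := W.s_diff.continuous
  unfold G g
  fun_prop

lemma G_local {l2 l1 l0 : ℂ} (hL : W.OnCurveL l2 l1 l0) {p0 : ℂ} (hp0 : p0 ∉ W.Γ) :
    ∃ r > 0, ∀ p ∈ Metric.ball p0 r, ∀ q ∈ Metric.ball p0 r, W.G p q = W.σ p * W.σ q := by
  have h0 : W.G p0 p0 ≠ 0 := by
    rw [G_diag, S]; exact pow_ne_zero 2 (W.σ_ne hp0)
  have hev : ∀ᶠ x : ℂ × ℂ in nhds (p0, p0), W.G x.1 x.2 ≠ 0 :=
    W.G_cont.continuousAt.eventually_ne h0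
  obtain ⟨r, hr, hb⟩ := Metric.eventually_nhds_iff_ball.1 hev
  refine ⟨r, hr, ?_⟩
  have hne : ∀ p ∈ Metric.ball p0 r, ∀ q ∈ Metric.ball p0 r, W.G p q ≠ 0 := by
    intro p hp q hq
    refine hb (p, q) ?_
    rw [← ball_prod_same]
    exact ⟨hp, hq⟩
  have hσne : ∀ p ∈ Metric.ball p0 r, W.σ p ≠ 0 := by
    intro p hp h
    apply hne p hp p hp
    rw [G_diag, S, h]; norm_num
  have hpre : IsPreconnected (Metric.ball p0 r) := (convex_ball p0 r).isPreconnected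
  have K : ∀ p ∈ Metric.ball p0 r, ∀ q ∈ Metric.ball p0 r,
      W.Gp p q * W.σ p = W.G p q * deriv W.σ p := by
    intro p hp q hq
    have hd : ∀ q ∈ Metric.ball p0 r, HasDerivAt (fun q => W.Gp p q / W.G p q) 0 q := by
      intro q hq
      refine ((W.hGpq p q).fun_div (W.hGq p q) (hne p hp q hq)).congr_deriv ?_
      have := W.wave hL ((p + q) / 2) ((p - q) / 2)
      rw [div_eq_zero_iff]
      left
      simp only [Gpq, Gp, Gq, G]
      linear_combination this / 4
    have hc := Metric.isOpen_ball.is_const_of_deriv_eq_zero hpre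
      (fun q hq => (hd q hq).differentiableAt.differentiableWithinAt)
      (fun q hq => (hd q hq).deriv) hq hp
    rw [Gp_diag, G_diag, dS', S, div_eq_div_iff (hne p hp q hq) (pow_ne_zero 2 (hσne p hp))] at hc
    apply mul_right_cancel₀ (hσne p hp)
    linear_combination hc
  intro p hp q hq
  have hd : ∀ p ∈ Metric.ball p0 r, HasDerivAt (fun p => W.G p q / W.σ p) 0 p := by
    intro p hp
    refine ((W.hGp p q).fun_div (W.hσ p) (hσne p hp)).congr_deriv ?_
    rw [div_eq_zero_iff]
    left
    rw [K p hp q hq, sub_self]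
  have hc := Metric.isOpen_ball.is_const_of_deriv_eq_zero hpre
      (fun q hq => (hd q hq).differentiableAt.differentiableWithinAt)
      (fun q hq => (hd q hq).deriv) hp hq
  rw [G_diag, S, div_eq_div_iff (hσne p hp) (hσne q hq)] at hc
  apply mul_right_cancel₀ (hσne q hq)
  linear_combination hc

lemma G_eq {l2 l1 l0 : ℂ} (hL : W.OnCurveL l2 l1 l0) {p0 : ℂ} (hp0 : p0 ∉ W.Γ) (p q : ℂ) :
    W.G p q = W.σ p * W.σ q := by
  obtain ⟨r, hr, h⟩ := W.G_local hL hp0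
  have hball := Metric.ball_mem_nhds p0 hr
  have h1 : ∀ p ∈ Metric.ball p0 r, ∀ q, W.G p q = W.σ p * W.σ q := by
    intro p hp q
    have d1 : Differentiable ℂ (fun q => W.G p q) := fun q => (W.hGq p q).differentiableAt
    have d2 : Differentiable ℂ (fun q => W.σ p * W.σ q) := W.σ_diff.const_mul _
    have := AnalyticOnNhd.eq_of_eventuallyEq (z₀ := p0)
      (fun x _ => d1.analyticAt x) (fun x _ => d2.analyticAt x)
      (by filter_upwards [hball] with q hq using h p hp q hq)
    exact congrFun this q
  have d1 : Differentiable ℂ (fun p => W.G p q) := fun p => (W.hGp p q).differentiableAt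
  have d2 : Differentiable ℂ (fun p => W.σ p * W.σ q) := W.σ_diff.mul_const _
  have := AnalyticOnNhd.eq_of_eventuallyEq (z₀ := p0)
    (fun x _ => d1.analyticAt x) (fun x _ => d2.analyticAt x)
    (by filter_upwards [hball] with p hp using h1 p hp q)
  exact congrFun this p

lemma sigma_add {l2 l1 l0 : ℂ} (hL : W.OnCurveL l2 l1 l0) {u v : ℂ} (hu : u ∉ W.Γ)
    (hv : v ∉ W.Γ) :
    W.σ (u + v) * W.σ (u - v) = (W.℘ v - W.℘ u) * (W.σ u ^ 2 * W.σ v ^ 2) := by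
  rw [← W.G_eq hL hu]
  have e1 : (u + v + (u - v)) / 2 = u := by ring
  have e2 : (u + v - (u - v)) / 2 = v := by ring
  rw [G, e1, e2, g, W.s_eq hu, W.s_eq hv, S, S]
  ring

lemma zeta_add {l2 l1 l0 : ℂ} (hL : W.OnCurveL l2 l1 l0) {u v : ℂ} (hu : u ∉ W.Γ)
    (hv : v ∉ W.Γ) (hp : u + v ∉ W.Γ) (hm : u - v ∉ W.Γ) :
    2 * (W.ζ (u + v) - W.ζ u - W.ζ v) * (W.℘ v - W.℘ u) = deriv W.℘ v - deriv W.℘ u := by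
  have F := W.sigma_add hL hu hv
  have hSu := W.σ_ne hu
  have hSv := W.σ_ne hv
  have e1 : (fun u => W.σ (u + v) * W.σ (u - v)) =ᶠ[nhds u]
      fun u => (W.℘ v - W.℘ u) * (W.σ u ^ 2 * W.σ v ^ 2) := by
    filter_upwards [W.ev hu] with x hx using W.sigma_add hL hx hv
  have e2 : (fun v => W.σ (u + v) * W.σ (u - v)) =ᶠ[nhds v]
      fun v => (W.℘ v - W.℘ u) * (W.σ u ^ 2 * W.σ v ^ 2) := by
    filter_upwards [W.ev hv] with x hx using W.sigma_add hL hu hx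
  have r1 := ((comp_aux W.σ_diff ((hasDerivAt_id' u).add_const v)).fun_mul
    (comp_aux W.σ_diff ((hasDerivAt_id' u).sub_const v))).deriv
  have r2 := ((comp_aux W.σ_diff ((hasDerivAt_id' v).const_add u)).fun_mul
    (comp_aux W.σ_diff ((hasDerivAt_id' v).const_sub u))).deriv
  have t1 := (((W.℘_diff u hu).hasDerivAt.const_sub (W.℘ v)).fun_mul
    (((W.hσ u).fun_pow 2).mul_const (W.σ v ^ 2))).deriv
  have t2 := (((W.℘_diff v hv).hasDerivAt.sub_const (W.℘ u)).fun_mul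
    (((W.hσ v).fun_pow 2).const_mul (W.σ u ^ 2))).deriv
  have k1 := e1.deriv_eq
  have k2 := e2.deriv_eq
  rw [r1, t1] at k1
  rw [r2, t2] at k2
  rw [W.dσ hp, W.dσ hm, W.dσ hu] at k1
  rw [W.dσ hp, W.dσ hm, W.dσ hv] at k2
  norm_num at k1 k2
  have hne : W.σ u ^ 2 * W.σ v ^ 2 ≠ 0 := mul_ne_zero (pow_ne_zero 2 hSu) (pow_ne_zero 2 hSv)
  apply mul_right_cancel₀ hne
  linear_combination k1 + k2 - 2 * W.ζ (u + v) * F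

lemma ℘_ne {l2 l1 l0 : ℂ} (hL : W.OnCurveL l2 l1 l0) {u v : ℂ} (hu : u ∉ W.Γ)
    (hv : v ∉ W.Γ) (hp : u + v ∉ W.Γ) (hm : u - v ∉ W.Γ) : W.℘ v - W.℘ u ≠ 0 := by
  intro h
  have F := W.sigma_add hL hu hv
  rw [h, zero_mul] at F
  exact mul_ne_zero (W.σ_ne hp) (W.σ_ne hm) F

lemma P_add {l2 l1 l0 : ℂ} (hL : W.OnCurveL l2 l1 l0) {u v : ℂ} (hu : u ∉ W.Γ)
    (hv : v ∉ W.Γ) (hp : u + v ∉ W.Γ) (hm : u - v ∉ W.Γ) :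
    (W.ζ (u + v) - W.ζ u - W.ζ v) ^ 2 = W.℘ u + W.℘ v + W.℘ (u + v) + l2 := by
  have Z := W.zeta_add hL hu hv hp hm
  have hd := W.℘_ne hL hu hv hp hm
  have evp : ∀ᶠ x in nhds u, x + v ∉ W.Γ :=
    (by fun_prop : Continuous fun x : ℂ => x + v).continuousAt.eventually (W.ev hp)
  have evm : ∀ᶠ x in nhds u, x - v ∉ W.Γ :=
    (by fun_prop : Continuous fun x : ℂ => x - v).continuousAt.eventually (W.ev hm)
  have e : (fun u => 2 * (W.ζ (u + v) - W.ζ u - W.ζ v) * (W.℘ v - W.℘ u)) =ᶠ[nhds u]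
      fun u => deriv W.℘ v - deriv W.℘ u := by
    filter_upwards [W.ev hu, evp, evm] with x h1 h2 h3 using W.zeta_add hL h1 hv h2 h3
  have r := ((((((W.hζ hp).comp_add_const u v).fun_sub (W.hζ hu)).sub_const (W.ζ v)).const_mul
    2).fun_mul ((W.℘_diff u hu).hasDerivAt.const_sub (W.℘ v))).deriv
  have t := ((W.℘_diff2 u hu).hasDerivAt.const_sub (deriv W.℘ v)).deriv
  have k := e.deriv_eq
  rw [r, t, W.dd℘ hL hu] at k
  have hu2 := hL u hu
  have hv2 := hL v hv
  set A := W.ζ (u + v) - W.ζ u - W.ζ v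
  set d := W.℘ v - W.℘ u with hdd
  have hfin : 2 * d * (2 * d) * (A ^ 2 - (W.℘ u + W.℘ v + W.℘ (u + v) + l2)) = 0 := by
    have k' : 2 * (W.℘ u - W.℘ (u + v)) * d = 2 * A * deriv W.℘ u
        - (6 * W.℘ u ^ 2 + 4 * l2 * W.℘ u + 2 * l1) := by linear_combination k
    have hA : 4 * d ^ 2 * A ^ 2 + 4 * d * A * deriv W.℘ u
        = 4 * (W.℘ v ^ 3 + l2 * W.℘ v ^ 2 + l1 * W.℘ v + l0)
        - 4 * (W.℘ u ^ 3 + l2 * W.℘ u ^ 2 + l1 * W.℘ u + l0) := by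
      linear_combination (2 * A * d + deriv W.℘ v + deriv W.℘ u) * Z + 4 * hv2 - 4 * hu2
    have : W.℘ v = d + W.℘ u := by rw [hdd]; ring
    rw [this] at hA ⊢
    linear_combination hA + 2 * d * k'
  have := (mul_eq_zero.1 hfin).resolve_left
    (mul_ne_zero (mul_ne_zero two_ne_zero hd) (mul_ne_zero two_ne_zero hd))
  exact sub_eq_zero.1 this

end WeierstrassData

/-- The algebraic differential relation
`[-i∂ₜ + α∂ᵤ]Ψ - (1/2)∂ᵤ²Ψ + (Ψ*Ψ)Ψ = (1/2)(2β + α² - 3℘(v) - λ₂)Ψ`,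
the elliptic-function form of the NLS equation (for `λ₂ = 0`). -/
theorem elliptic_NLS_relation (W : WeierstrassData) (l2 l1 l0 : ℂ)
    (hL : W.OnCurveL l2 l1 l0) (α β c : ℂ) (v : ℂ) (hv : v ∉ W.Γ)
    (Ψ Ψs : ℂ → ℂ → ℂ)
    (hΨ : ∀ u t, Ψ u t = Complex.exp (α * u + Complex.I * β * t + c - W.ζ v * u)
        * W.σ (u + v) / (W.σ u * W.σ v))
    (hΨs : ∀ u t, Ψs u t
        = -(Complex.exp (-(α * u) - Complex.I * β * t - c + W.ζ v * u)
            * W.σ (u - v) / (W.σ u * W.σ v)))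
    (u t : ℂ) (hu : u ∉ W.Γ) (huv : u + v ∉ W.Γ) (huv' : u - v ∉ W.Γ) :
    (- Complex.I * deriv (fun s => Ψ u s) t + α * deriv (fun s => Ψ s t) u)
      - (1 / 2) * deriv (fun s => deriv (fun r => Ψ r t) s) u
      + (Ψs u t * Ψ u t) * Ψ u t
      = (1 / 2) * (2 * β + α ^ 2 - 3 * W.℘ v - l2) * Ψ u t := by
  have hσu := W.σ_ne hu
  have hσv := W.σ_ne hv
  have Ht : HasDerivAt (fun s => Ψ u s) (Complex.I * β * Ψ u t) t := by
    have e1 : HasDerivAt (fun s : ℂ => α * u + Complex.I * β * s + c - W.ζ v * u)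
        (Complex.I * β * 1) t :=
      ((((hasDerivAt_id' t).const_mul (Complex.I * β)).const_add (α * u)).add_const c).sub_const _
    have e2 := (e1.cexp.mul_const (W.σ (u + v))).div_const (W.σ u * W.σ v)
    have e3 : (fun s => Ψ u s) = fun s =>
        Complex.exp (α * u + Complex.I * β * s + c - W.ζ v * u)
        * W.σ (u + v) / (W.σ u * W.σ v) := funext (hΨ u)
    rw [e3, hΨ]
    refine e2.congr_deriv ?_
    ring
  have Hu : ∀ x, x ∉ W.Γ → x + v ∉ W.Γ →
      HasDerivAt (fun s => Ψ s t) ((α + (W.ζ (x + v) - W.ζ x - W.ζ v)) * Ψ x t) x := by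
    intro x hx hxv
    have hσx := W.σ_ne hx
    have e1 : HasDerivAt (fun s : ℂ => α * s + Complex.I * β * t + c - W.ζ v * s)
        (α * 1 - W.ζ v * 1) x :=
      ((((hasDerivAt_id' x).const_mul α).add_const _).add_const c).fun_sub
        ((hasDerivAt_id' x).const_mul (W.ζ v))
    have e2 := (e1.cexp.fun_mul ((W.hσ (x + v)).comp_add_const x v)).fun_div
      ((W.hσ x).mul_const (W.σ v)) (mul_ne_zero hσx hσv)
    have e3 : (fun s => Ψ s t) = fun s =>
        Complex.exp (α * s + Complex.I * β * t + c - W.ζ v * s)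
        * W.σ (s + v) / (W.σ s * W.σ v) := funext (fun s => hΨ s t)
    rw [e3, hΨ]
    refine e2.congr_deriv ?_
    rw [W.dσ hx, W.dσ hxv]
    field_simp
    ring
  have evp : ∀ᶠ x in nhds u, x + v ∉ W.Γ :=
    (by fun_prop : Continuous fun x : ℂ => x + v).continuousAt.eventually (W.ev huv)
  have e : (fun s => deriv (fun r => Ψ r t) s) =ᶠ[nhds u]
      fun x => (α + (W.ζ (x + v) - W.ζ x - W.ζ v)) * Ψ x t := by
    filter_upwards [W.ev hu, evp] with x h1 h2 using (Hu x h1 h2).deriv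
  have r := ((((((W.hζ huv).comp_add_const u v).fun_sub (W.hζ hu)).sub_const
    (W.ζ v)).const_add α).fun_mul (Hu u hu huv)).deriv
  have hprod : Ψs u t * Ψ u t = W.℘ u - W.℘ v := by
    have F := W.sigma_add hL hu hv
    have hexp : Complex.exp (-(α * u) - Complex.I * β * t - c + W.ζ v * u)
        * Complex.exp (α * u + Complex.I * β * t + c - W.ζ v * u) = 1 := by
      rw [← Complex.exp_add, ← Complex.exp_zero]
      congr 1
      ring
    rw [hΨ, hΨs]
    have : W.℘ u - W.℘ v = -(W.σ (u + v) * W.σ (u - v)) / (W.σ u ^ 2 * W.σ v ^ 2) := by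
      rw [F]; field_simp; ring
    rw [this]
    calc _ = -((Complex.exp (-(α * u) - Complex.I * β * t - c + W.ζ v * u)
        * Complex.exp (α * u + Complex.I * β * t + c - W.ζ v * u)) *
        (W.σ (u + v) * W.σ (u - v))) / (W.σ u ^ 2 * W.σ v ^ 2) := by field_simp
      _ = _ := by rw [hexp, one_mul]
  have P := W.P_add hL hu hv huv huv'
  rw [Ht.deriv, (Hu u hu huv).deriv, e.deriv_eq, r, hprod]
  linear_combination (-(1 / 2) * Ψ u t) * P - β * Ψ u t * Complex.I_sq
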